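/- Let n be a positive integer, R an n×n real symmetric positive definite matrix, a<b reals, and x:[a,b]→ℝⁿ a continuously differentiable function. Define Ω₅ = x(b) − (1/(b−a))∫_a^b x(u)du and Ω₆ = x(b) + (2/(b−a))∫_a^b x(u)du − (6/(b−a)²)∫_a^b∫_s^b x(u)du ds. Then −∫_a^b∫_s^b ẋ(u)ᵀRẋ(u)du ds ≤ −2Ω₅ᵀRΩ₅ − 4Ω₆ᵀRΩ₆. -/

import Mathlib

open Matrix intervalIntegral

/-- Exchanging the order of integration over the triangle `a ≤ s ≤ u ≤ b`. -/
theorem integral_integral_right_eq_integral_sub_smul {E : Type*} [NormedAddCommGroup E]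
    [NormedSpace ℝ E] [CompleteSpace E] {a b : ℝ} (hab : a ≤ b) {f : ℝ → E}
    (hf : ContinuousOn f (Set.Icc a b)) :
    ∫ s in a..b, ∫ u in s..b, f u = ∫ u in a..b, (u - a) • f u := by
  have hint : IntervalIntegrable f MeasureTheory.volume a b :=
    hf.intervalIntegrable_of_Icc hab
  have hprim : ContinuousOn (fun s => ∫ u in s..b, f u) (Set.uIcc a b) :=
    continuousOn_primitive_interval_left
      (by rw [Set.uIcc_of_le hab]; exact hf.integrableOn_Icc)
  have hparts := integral_smul_deriv_eq_deriv_smul_of_hasDerivAt (a := a) (b := b)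
    (u := fun s => s - a) (u' := fun _ => (1 : ℝ)) (v := fun s => ∫ u in s..b, f u)
    (v' := fun s => -f s) (by fun_prop) hprim
    (fun s _ => (hasDerivAt_id s).sub_const a)
    (fun s hs => by
      rw [min_eq_left hab, max_eq_right hab] at hs
      have hnhds : Set.Icc a b ∈ nhds s := Icc_mem_nhds hs.1 hs.2
      refine integral_hasDerivAt_left
        ((hf.mono (Set.Icc_subset_Icc_left hs.1.le)).intervalIntegrable_of_Icc hs.2.le)
        ?_ (hf.continuousAt hnhds)
      exact (hf.mono Set.Ioo_subset_Icc_self).stronglyMeasurableAtFilter isOpen_Ioo s hs)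
    (by simp) hint.neg
  simp only [smul_neg, integral_neg, integral_same, smul_zero, sub_self, zero_smul, one_smul,
    zero_sub, neg_inj] at hparts
  exact hparts.symm

/-- The interval integral commutes with the dot product with a fixed vector. -/
theorem integral_dotProduct_mulVec {ι : Type*} [Fintype ι] {a b : ℝ} (R : Matrix ι ι ℝ)
    (v : ι → ℝ) {f : ℝ → ι → ℝ} (hf : IntervalIntegrable f MeasureTheory.volume a b) :
    ∫ u in a..b, v ⬝ᵥ R *ᵥ f u = v ⬝ᵥ R *ᵥ ∫ u in a..b, f u :=
  ((dotProductBilin ℝ ℝ v).comp R.mulVecLin).toContinuousLinearMap.intervalIntegral_comp_comm hf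

/-- A positive semidefinite quadratic form lies above its tangents. -/
theorem Matrix.PosSemidef.two_mul_dotProduct_sub_le {ι : Type*} [Fintype ι] {R : Matrix ι ι ℝ}
    (hR : R.PosSemidef) (v y : ι → ℝ) :
    2 * (y ⬝ᵥ R *ᵥ v) - y ⬝ᵥ R *ᵥ y ≤ v ⬝ᵥ R *ᵥ v := by
  have hnonneg := hR.dotProduct_mulVec_nonneg (v - y)
  have hsymm : v ⬝ᵥ R *ᵥ y = y ⬝ᵥ R *ᵥ v := by
    have hT : Rᵀ = R := hR.isHermitian
    rw [dotProduct_mulVec, ← mulVec_transpose, hT, dotProduct_comm]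
  simp only [star_trivial, mulVec_sub, dotProduct_sub, sub_dotProduct] at hnonneg
  linarith

theorem double_integral_inequality_upper
    {n : ℕ} (hn : 0 < n)
    (a b : ℝ) (hab : a < b)
    (R : Matrix (Fin n) (Fin n) ℝ) (hR : R.PosDef)
    (x x' : ℝ → Fin n → ℝ)
    (hderiv : ∀ u ∈ Set.Icc a b, HasDerivAt x (x' u) u)
    (hx' : ContinuousOn x' (Set.Icc a b))
    (Ω5 Ω6 : Fin n → ℝ)
    (hΩ5 : Ω5 = x b - (1/(b-a)) • (∫ u in a..b, x u))
    (hΩ6 : Ω6 = x b + (2/(b-a)) • (∫ u in a..b, x u)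
        - (6/(b-a)^2) • (∫ s in a..b, ∫ u in s..b, x u)) :
    -(∫ s in a..b, ∫ u in s..b, x' u ⬝ᵥ R *ᵥ x' u) ≤
      -(2 * (Ω5 ⬝ᵥ R *ᵥ Ω5)) - 4 * (Ω6 ⬝ᵥ R *ᵥ Ω6) := by
  have hL : b - a ≠ 0 := (sub_pos.2 hab).ne'
  have hx : ContinuousOn x (Set.Icc a b) := fun u hu =>
    (hderiv u hu).continuousAt.continuousWithinAt
  have hq : ContinuousOn (fun u => x' u ⬝ᵥ R *ᵥ x' u) (Set.Icc a b) := by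
    simp only [dotProduct, mulVec]
    fun_prop
  have hderiv' : ∀ u ∈ Set.uIcc a b, HasDerivAt x (x' u) u := by
    rwa [Set.uIcc_of_le hab.le]
  have hxi : IntervalIntegrable x MeasureTheory.volume a b :=
    hx.intervalIntegrable_of_Icc hab.le
  have hx'i : IntervalIntegrable x' MeasureTheory.volume a b :=
    hx'.intervalIntegrable_of_Icc hab.le
  rw [integral_integral_right_eq_integral_sub_smul hab.le hx] at hΩ6
  rw [integral_integral_right_eq_integral_sub_smul hab.le hq]
  have hxwi : IntervalIntegrable (fun u => (u - a) • x u) MeasureTheory.volume a b :=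
    ContinuousOn.intervalIntegrable_of_Icc hab.le (by fun_prop)
  -- The weight `u - a` has orthogonal polynomials `1` and `3 * (u - a) / (b - a) - 2`;
  -- `Ω5` and `Ω6` are the corresponding moments of `x'`.
  have hmoment5 : ∫ u in a..b, (u - a) • x' u = (b - a) • Ω5 := by
    rw [integral_smul_deriv_eq_deriv_smul (u := fun u => u - a) (u' := fun _ => (1 : ℝ))
      (fun u _ => (hasDerivAt_id u).sub_const a) hderiv' (by simp) hx'i, hΩ5]
    simp only [sub_self, zero_smul, sub_zero, one_smul, smul_sub, smul_smul]
    rw [mul_one_div_cancel hL, one_smul]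
  have hmoment6 : ∫ u in a..b, (3 * (u - a) ^ 2 / (b - a) - 2 * (u - a)) • x' u
      = (b - a) • Ω6 := by
    rw [integral_smul_deriv_eq_deriv_smul
      (u := fun u => 3 * (u - a) ^ 2 / (b - a) - 2 * (u - a))
      (u' := fun u => 6 / (b - a) * (u - a) - 2)
      (fun u _ => by
        have h := (hasDerivAt_id u).sub_const a
        refine ((((h.pow 2).const_mul 3).div_const (b - a)).sub (h.const_mul 2)).congr_deriv ?_
        simp only [id]
        push_cast
        ring)
      hderiv' (Continuous.intervalIntegrable (by fun_prop) a b) hx'i, hΩ6]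
    simp only [sub_smul _ (2 : ℝ), mul_smul _ (_ - a)]
    rw [integral_sub (f := fun u => (6 / (b - a)) • (u - a) • x u) (g := fun u => (2 : ℝ) • x u)
      (hxwi.smul (6 / (b - a))) (hxi.smul (2 : ℝ)), integral_smul, integral_smul]
    ext i
    simp only [Pi.sub_apply, Pi.add_apply, Pi.smul_apply, smul_eq_mul]
    field_simp
    ring
  set c := (2 / (b - a)) • Ω5 with hc
  set d := (4 / (b - a)) • Ω6 with hd
  have hcross5 : IntervalIntegrable (fun u => c ⬝ᵥ R *ᵥ ((u - a) • x' u))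
      MeasureTheory.volume a b := by
    refine ContinuousOn.intervalIntegrable_of_Icc hab.le ?_
    simp only [dotProduct, mulVec, Pi.smul_apply]
    fun_prop
  have hcross6 : IntervalIntegrable
      (fun u => d ⬝ᵥ R *ᵥ ((3 * (u - a) ^ 2 / (b - a) - 2 * (u - a)) • x' u))
      MeasureTheory.volume a b := by
    refine ContinuousOn.intervalIntegrable_of_Icc hab.le ?_
    simp only [dotProduct, mulVec, Pi.smul_apply]
    fun_prop
  have hpoly : ∀ A B C : ℝ, ∫ u in a..b, ((u - a) * A
      + (3 * (u - a) ^ 2 / (b - a) - 2 * (u - a)) * B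
      + (u - a) * (3 * (u - a) / (b - a) - 2) ^ 2 * C)
      = (b - a) ^ 2 / 2 * A + (b - a) ^ 2 / 4 * C := by
    intro A B C
    rw [integral_eq_sub_of_hasDerivAt (f := fun u => (u - a) ^ 2 / 2 * A
      + ((u - a) ^ 3 / (b - a) - (u - a) ^ 2) * B
      + (9 / 4 * (u - a) ^ 4 / (b - a) ^ 2 - 4 * (u - a) ^ 3 / (b - a)
        + 2 * (u - a) ^ 2) * C)]
    · simp only [sub_self]
      field_simp
      ring
    · intro u _
      have h := (hasDerivAt_id u).sub_const a
      refine (((((h.pow 2).div_const 2).mul_const A).add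
        ((((h.pow 3).div_const (b - a)).sub (h.pow 2)).mul_const B)).add
        ((((((h.pow 4).const_mul (9 / 4)).div_const ((b - a) ^ 2)).sub
          (((h.pow 3).const_mul 4).div_const (b - a))).add
          ((h.pow 2).const_mul 2)).mul_const C)).congr_deriv ?_
      simp only [id]
      push_cast
      field_simp
      ring
    · exact Continuous.intervalIntegrable (by fun_prop) a b
  have hpolyi : ∀ A B C : ℝ, IntervalIntegrable (fun u => (u - a) * A
      + (3 * (u - a) ^ 2 / (b - a) - 2 * (u - a)) * B
      + (u - a) * (3 * (u - a) / (b - a) - 2) ^ 2 * C) MeasureTheory.volume a b :=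
    fun A B C => Continuous.intervalIntegrable (by fun_prop) a b
  have hcrossi := (hcross5.const_mul 2).add (hcross6.const_mul 2)
  have hmono := integral_mono_on hab.le
    (hcrossi.sub (hpolyi (c ⬝ᵥ R *ᵥ c) (c ⬝ᵥ R *ᵥ d + d ⬝ᵥ R *ᵥ c) (d ⬝ᵥ R *ᵥ d)))
    (g := fun u => (u - a) • (x' u ⬝ᵥ R *ᵥ x' u))
    (ContinuousOn.intervalIntegrable_of_Icc hab.le (by fun_prop))
    (fun u hu => by
      have h := mul_le_mul_of_nonneg_left (hR.posSemidef.two_mul_dotProduct_sub_le (x' u)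
        (c + (3 * (u - a) / (b - a) - 2) • d)) (sub_nonneg.2 hu.1)
      refine le_trans (le_of_eq ?_) h
      simp only [mulVec_add, mulVec_smul, dotProduct_add, add_dotProduct, dotProduct_smul,
        smul_dotProduct, smul_eq_mul]
      ring)
  rw [integral_sub hcrossi (hpolyi _ _ _), hpoly,
    integral_add (hcross5.const_mul 2) (hcross6.const_mul 2), integral_const_mul,
    integral_const_mul, integral_dotProduct_mulVec R c, integral_dotProduct_mulVec R d,
    hmoment5, hmoment6, hc, hd] at hmono
  · simp only [mulVec_smul, dotProduct_smul, smul_dotProduct, smul_eq_mul] at hmono ⊢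
    field_simp at hmono
    linarith
  · exact ContinuousOn.intervalIntegrable_of_Icc hab.le (by fun_prop)
  · exact ContinuousOn.intervalIntegrable_of_Icc hab.le (by fun_prop)
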